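/- The ququart–ququart states ψ_1 = (1/2)(|00⟩+|11⟩+|22⟩+|33⟩), ψ_2 = (1/2)(|03⟩+|12⟩+|21⟩+|30⟩), ψ_3 = (1/2)(|01⟩+|10⟩−|23⟩−|32⟩) can be perfectly discriminated by a one-round LOCC protocol with two bits of communication in which both parties measure in the computational basis: defining M^1 := Σ_{a=0}^3 |a⟩⟨a| ⊗ |a⟩⟨a|, M^2 := Σ_{a=0}^3 |a⟩⟨a| ⊗ |3−a⟩⟨3−a|, M^3 := Σ_{a=0}^3 |a⟩⟨a| ⊗ |a XOR 1⟩⟨a XOR 1| (bitwise XOR on {0,1,2,3}), and M^4 := 𝟙₁₆ − M^1 − M^2 − M^3, the family (M^λ)_{λ=1}^4 is a measurement in 1R-LOCC₄ on ℂ⁴⊗ℂ⁴ (in particular each M^λ is positive semidefinite and Σ_λ M^λ = 𝟙), and ⟨ψ_λ, M^λ ψ_λ⟩ = 1 for λ = 1, 2, 3. -/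

import Mathlib

open scoped Kronecker BigOperators ComplexConjugate ComplexOrder
open Matrix

noncomputable section

/-- An `N`-outcome POVM on `ℂ^d`: positive semidefinite matrices summing to the identity. -/
def IsPOVM {d N : ℕ} (A : Fin N → Matrix (Fin d) (Fin d) ℂ) : Prop :=
  (∀ a, (A a).PosSemidef) ∧ ∑ a, A a = 1

/-- Membership in `1R-LOCC_m`: `M λ = ∑ a, A a ⊗ B (λ|a)` for an `m`-outcome POVM `A`
on Alice's side and `n`-outcome POVMs `B (·|a)` on Bob's side. -/
def Is1RLOCC (dA dB n m : ℕ)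
    (M : Fin n → Matrix (Fin dA × Fin dB) (Fin dA × Fin dB) ℂ) : Prop :=
  ∃ (A : Fin m → Matrix (Fin dA) (Fin dA) ℂ)
    (B : Fin m → Fin n → Matrix (Fin dB) (Fin dB) ℂ),
    IsPOVM A ∧ (∀ a, IsPOVM (B a)) ∧
      ∀ lam, M lam = ∑ a, A a ⊗ₖ B a lam

/-- The three maximally entangled ququart–ququart states
`ψ_1 = (1/2)(|00⟩+|11⟩+|22⟩+|33⟩)`, `ψ_2 = (1/2)(|03⟩+|12⟩+|21⟩+|30⟩)`,
`ψ_3 = (1/2)(|01⟩+|10⟩−|23⟩−|32⟩)`, indexed here by `Fin 3`. -/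
def ququart : Fin 3 → Fin 4 → Fin 4 → ℂ :=
  ![ fun a b => if a = b then (1 / 2 : ℂ) else 0,
     fun a b => if (a : ℕ) + (b : ℕ) = 3 then (1 / 2 : ℂ) else 0,
     fun a b =>
       if (a = 0 ∧ b = 1) ∨ (a = 1 ∧ b = 0) then (1 / 2 : ℂ)
       else if (a = 2 ∧ b = 3) ∨ (a = 3 ∧ b = 2) then -(1 / 2 : ℂ)
       else 0 ]

/-- `M^1 = ∑_a |a⟩⟨a| ⊗ |a⟩⟨a|`. -/
def M1 : Matrix (Fin 4 × Fin 4) (Fin 4 × Fin 4) ℂ :=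
  Matrix.of fun p q => if p = q ∧ p.2 = p.1 then 1 else 0

/-- `M^2 = ∑_a |a⟩⟨a| ⊗ |3−a⟩⟨3−a|`. -/
def M2 : Matrix (Fin 4 × Fin 4) (Fin 4 × Fin 4) ℂ :=
  Matrix.of fun p q => if p = q ∧ (p.1 : ℕ) + (p.2 : ℕ) = 3 then 1 else 0

/-- `M^3 = ∑_a |a⟩⟨a| ⊗ |a XOR 1⟩⟨a XOR 1|` (bitwise XOR on `{0,1,2,3}`). -/
def M3 : Matrix (Fin 4 × Fin 4) (Fin 4 × Fin 4) ℂ :=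
  Matrix.of fun p q => if p = q ∧ (p.2 : ℕ) = (p.1 : ℕ) ^^^ 1 then 1 else 0

/-- `M^4 = 𝟙₁₆ − M^1 − M^2 − M^3`. -/
def M4 : Matrix (Fin 4 × Fin 4) (Fin 4 × Fin 4) ℂ := 1 - M1 - M2 - M3

/-- The four-outcome family `(M^λ)`. -/
def Ms : Fin 4 → Matrix (Fin 4 × Fin 4) (Fin 4 × Fin 4) ℂ := ![M1, M2, M3, M4]

/-- The expectation value `⟨ψ, M ψ⟩` of a ququart–ququart operator in a vector. -/
def expVal4 (M : Matrix (Fin 4 × Fin 4) (Fin 4 × Fin 4) ℂ) (ψ : Fin 4 → Fin 4 → ℂ) : ℂ :=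
  ∑ p : Fin 4 × Fin 4, ∑ q : Fin 4 × Fin 4,
    conj (ψ p.1 p.2) * M p q * ψ q.1 q.2

/-- The projective measurement in the standard basis whose results are relabelled by `f`:
the outcome `a` has as its effect the projection onto the span of the basis vectors in `f ⁻¹ {a}`. -/
def relabelledBasisMeasurement {ι κ : Type*} [DecidableEq ι] [DecidableEq κ] (f : ι → κ) (a : κ) :
    Matrix ι ι ℂ :=
  diagonal fun i => if f i = a then 1 else 0

lemma posSemidef_relabelledBasisMeasurement {ι κ : Type*} [DecidableEq ι] [DecidableEq κ]
    (f : ι → κ) (a : κ) : (relabelledBasisMeasurement f a).PosSemidef := by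
  refine PosSemidef.diagonal fun i => ?_
  dsimp only [Pi.zero_apply]
  split_ifs <;> simp

lemma sum_relabelledBasisMeasurement {ι κ : Type*} [DecidableEq ι] [DecidableEq κ] [Fintype κ]
    (f : ι → κ) : ∑ a, relabelledBasisMeasurement f a = 1 := by
  ext i j
  by_cases h : i = j <;>
    simp [relabelledBasisMeasurement, Matrix.sum_apply, Matrix.one_apply, h]

lemma isPOVM_relabelledBasisMeasurement {d N : ℕ} (f : Fin d → Fin N) :
    IsPOVM (relabelledBasisMeasurement f) :=
  ⟨posSemidef_relabelledBasisMeasurement f, sum_relabelledBasisMeasurement f⟩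

/-- If Alice measures in the standard basis and Bob measures in the standard basis and announces
a function of both results, the outcome is a relabelling of the product basis measurement. -/
lemma relabelledBasisMeasurement_eq_sum_kronecker {ι κ μ : Type*} [DecidableEq ι] [DecidableEq κ]
    [DecidableEq μ] [Fintype ι] (f : ι × κ → μ) (c : μ) :
    relabelledBasisMeasurement f c =
      ∑ a, relabelledBasisMeasurement id a ⊗ₖ relabelledBasisMeasurement (fun b => f (a, b)) c := by
  ext ⟨i, k⟩ ⟨j, l⟩
  rw [Matrix.sum_apply, Fintype.sum_eq_single i fun a ha => by
    simp [relabelledBasisMeasurement, diagonal_apply, ha.symm]]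
  by_cases h : i = j <;> simp [relabelledBasisMeasurement, diagonal_apply, h]

lemma is1RLOCC_relabelledBasisMeasurement {dA dB n : ℕ} (f : Fin dA × Fin dB → Fin n) :
    Is1RLOCC dA dB n dA (relabelledBasisMeasurement f) :=
  ⟨relabelledBasisMeasurement id, fun a => relabelledBasisMeasurement fun b => f (a, b),
    isPOVM_relabelledBasisMeasurement _, fun _ => isPOVM_relabelledBasisMeasurement _,
    relabelledBasisMeasurement_eq_sum_kronecker f⟩

/-- The index of the effect `M^λ` that contains the product basis vector `|ab⟩`. -/
def ququartOutcome (p : Fin 4 × Fin 4) : Fin 4 :=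
  if p.2 = p.1 then 0
  else if (p.1 : ℕ) + (p.2 : ℕ) = 3 then 1
  else if (p.2 : ℕ) = (p.1 : ℕ) ^^^ 1 then 2
  else 3

lemma ququartOutcome_eq_zero_iff : ∀ p, ququartOutcome p = 0 ↔ p.2 = p.1 := by
  decide

lemma ququartOutcome_eq_one_iff : ∀ p, ququartOutcome p = 1 ↔ (p.1 : ℕ) + (p.2 : ℕ) = 3 := by
  decide

lemma ququartOutcome_eq_two_iff :
    ∀ p, ququartOutcome p = 2 ↔ (p.2 : ℕ) = (p.1 : ℕ) ^^^ 1 := by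
  decide

lemma Ms_eq_relabelledBasisMeasurement : Ms = relabelledBasisMeasurement ququartOutcome := by
  have h1 : M1 = relabelledBasisMeasurement ququartOutcome 0 := by
    ext p q
    simp [M1, relabelledBasisMeasurement, diagonal_apply, ququartOutcome_eq_zero_iff, ite_and]
  have h2 : M2 = relabelledBasisMeasurement ququartOutcome 1 := by
    ext p q
    simp [M2, relabelledBasisMeasurement, diagonal_apply, ququartOutcome_eq_one_iff, ite_and]
  have h3 : M3 = relabelledBasisMeasurement ququartOutcome 2 := by
    ext p q
    simp [M3, relabelledBasisMeasurement, diagonal_apply, ququartOutcome_eq_two_iff, ite_and]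
  have h4 : M4 = relabelledBasisMeasurement ququartOutcome 3 := by
    have hsum := sum_relabelledBasisMeasurement ququartOutcome
    rw [Fin.sum_univ_four] at hsum
    rw [M4, h1, h2, h3, ← hsum]
    abel
  funext lam
  fin_cases lam
  exacts [h1, h2, h3, h4]

/-- A relabelled basis measurement yields `c` with certainty on a unit vector supported in the
fibre of `c`. -/
lemma expVal4_relabelledBasisMeasurement {κ : Type*} [DecidableEq κ] (f : Fin 4 × Fin 4 → κ)
    (c : κ) (ψ : Fin 4 → Fin 4 → ℂ) (hψ : ∀ p, f p ≠ c → ψ p.1 p.2 = 0) :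
    expVal4 (relabelledBasisMeasurement f c) ψ =
      ∑ p : Fin 4 × Fin 4, conj (ψ p.1 p.2) * ψ p.1 p.2 := by
  refine Finset.sum_congr rfl fun p _ => ?_
  by_cases h : f p = c
  · simp [relabelledBasisMeasurement, diagonal_apply, h]
  · simp [relabelledBasisMeasurement, diagonal_apply, h, hψ p h]

lemma ququart_eq_zero (i : Fin 3) (p : Fin 4 × Fin 4) (h : ququartOutcome p ≠ i.castSucc) :
    ququart i p.1 p.2 = 0 := by
  obtain ⟨a, b⟩ := p
  fin_cases i <;> fin_cases a <;> fin_cases b <;>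
    first | exact absurd (by decide) h | simp [ququart]

lemma sum_conj_mul_self_ququart (i : Fin 3) :
    ∑ p : Fin 4 × Fin 4, conj (ququart i p.1 p.2) * ququart i p.1 p.2 = 1 := by
  fin_cases i <;>
    simp [ququart, Fintype.sum_prod_type, Fin.sum_univ_four, Complex.conj_ofNat] <;> norm_num

/-- **Perfect discrimination of the three ququart–ququart states by a one-round LOCC
protocol with two bits of communication (computational-basis measurements):**
`(M^λ)_{λ=1}^4` is a measurement in `1R-LOCC₄` (in particular each `M^λ` is PSD and
they sum to the identity), and `⟨ψ_λ, M^λ ψ_λ⟩ = 1` for `λ = 1, 2, 3`. -/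
theorem ququart_perfect_discrimination :
    Is1RLOCC 4 4 4 4 Ms ∧
    (∀ lam : Fin 4, (Ms lam).PosSemidef) ∧
    (∑ lam : Fin 4, Ms lam = 1) ∧
    (∀ i : Fin 3, expVal4 (Ms (Fin.castSucc i)) (ququart i) = 1) := by
  rw [Ms_eq_relabelledBasisMeasurement]
  refine ⟨is1RLOCC_relabelledBasisMeasurement _, posSemidef_relabelledBasisMeasurement _,
    sum_relabelledBasisMeasurement _, fun i => ?_⟩
  rw [expVal4_relabelledBasisMeasurement _ _ _ (ququart_eq_zero i), sum_conj_mul_self_ququart]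

end
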